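/- Let G be a group, n ≥ 3 an integer, and σ_1, …, σ_{n-1} elements of G satisfying (σ_i σ_{i+1} ⋯ σ_j)^2 = 1 for all 1 ≤ i < j ≤ n-1. Let ρ : G → G be a group automorphism. Then the following are equivalent: (a) ρ(σ_1) = σ_1^{-1}, ρ(σ_2) = σ_1^2 σ_2, and ρ(σ_i) = σ_i for all 3 ≤ i ≤ n-1; (b) ρ(σ_1 σ_2 ⋯ σ_j) = (σ_1 σ_2 ⋯ σ_j)^{-1} for all 1 ≤ j ≤ n-1 (i.e., ρ inverts every element of the tuple φ(σ_1,…,σ_{n-1}) = (σ_1, σ_1σ_2, …, σ_1σ_2⋯σ_{n-1})). In particular, there exists an automorphism of G satisfying (a) if and only if there exists an automorphism of G satisfying (b). -/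

import Mathlib

/-- The ordered product `σ r * σ (r+1) * ⋯ * σ s` (empty if `s < r`). -/
def partialProd {G : Type*} [Group G] (σ : ℕ → G) (r s : ℕ) : G :=
  ((List.Ico r (s + 1)).map σ).prod

theorem partialProd_self {G : Type*} [Group G] (σ : ℕ → G) (r : ℕ) :
    partialProd σ r r = σ r := by
  simp [partialProd]

theorem partialProd_succ {G : Type*} [Group G] (σ : ℕ → G) {r s : ℕ} (h : r ≤ s + 1) :
    partialProd σ r (s + 1) = partialProd σ r s * σ (s + 1) := by
  simp [partialProd, List.Ico.succ_top h]

/-- The equivalence for a single endomorphism only needs the products starting at `σ 1`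
to square to `1`. -/
theorem map_conditions_iff_map_partialProd_eq_inv {G : Type*} [Group G] {m : ℕ} (hm : 2 ≤ m)
    (σ : ℕ → G) (hsq : ∀ j, 1 < j → j ≤ m → partialProd σ 1 j ^ 2 = 1) (ρ : G →* G) :
    (ρ (σ 1) = (σ 1)⁻¹ ∧ ρ (σ 2) = σ 1 ^ 2 * σ 2 ∧ ∀ i, 3 ≤ i → i ≤ m → ρ (σ i) = σ i) ↔
      ∀ j, 1 ≤ j → j ≤ m → ρ (partialProd σ 1 j) = (partialProd σ 1 j)⁻¹ := by
  have hinv : ∀ j, 1 < j → j ≤ m → (partialProd σ 1 j)⁻¹ = partialProd σ 1 j := fun j h1 hj =>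
    inv_eq_of_mul_eq_one_left (by rw [← sq, hsq j h1 hj])
  have htwo : partialProd σ 1 2 = σ 1 * σ 2 := by
    rw [partialProd_succ σ (by omega), partialProd_self]
  constructor
  · rintro ⟨h1, h2, h3⟩
    have hfix : ∀ j, 2 ≤ j → j ≤ m → ρ (partialProd σ 1 j) = partialProd σ 1 j := by
      intro j hj
      induction j, hj using Nat.le_induction with
      | base =>
        intro _
        rw [htwo, map_mul, h1, h2]
        group
      | succ k hk ih =>
        intro hkm
        rw [partialProd_succ σ (by omega), map_mul, ih (by omega), h3 _ (by omega) hkm]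
    intro j hj hjm
    rcases hj.eq_or_lt with rfl | hj
    · rw [partialProd_self, h1]
    · rw [hfix j hj hjm, hinv j hj hjm]
  · intro h
    have h1 : ρ (σ 1) = (σ 1)⁻¹ := by simpa only [partialProd_self] using h 1 le_rfl (by omega)
    have hfix : ∀ j, 2 ≤ j → j ≤ m → ρ (partialProd σ 1 j) = partialProd σ 1 j :=
      fun j hj hjm => (h j (by omega) hjm).trans (hinv j hj hjm)
    refine ⟨h1, ?_, fun i hi him => ?_⟩
    · have h2 := hfix 2 le_rfl hm
      rw [htwo, map_mul, h1, inv_mul_eq_iff_eq_mul] at h2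
      rw [h2, sq, mul_assoc]
    · obtain ⟨k, rfl⟩ : ∃ k, i = k + 1 := ⟨i - 1, by omega⟩
      have hi := hfix (k + 1) (by omega) him
      rwa [partialProd_succ σ (by omega), map_mul, hfix k (by omega) (by omega),
        mul_left_cancel_iff] at hi

/-- If `(σ_i σ_{i+1} ⋯ σ_j)² = 1` for all `1 ≤ i < j ≤ n-1`, then an automorphism
`ρ` of `G` satisfies `ρ(σ_1) = σ_1⁻¹`, `ρ(σ_2) = σ_1² σ_2`, and `ρ(σ_i) = σ_i` for
`3 ≤ i ≤ n-1` if and only if `ρ` inverts every element of the tuple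
`φ(σ) = (σ_1, σ_1σ_2, …, σ_1σ_2⋯σ_{n-1})`. In particular, an automorphism
satisfying the first set of conditions exists iff one satisfying the second
exists. -/
theorem rho_conditions_iff_inverts_phi {G : Type*} [Group G] (n : ℕ) (hn : 3 ≤ n)
    (σ : ℕ → G)
    (hsq : ∀ i j, 1 ≤ i → i < j → j ≤ n - 1 → (partialProd σ i j) ^ 2 = 1) :
    (∀ ρ : G ≃* G,
      (ρ (σ 1) = (σ 1)⁻¹ ∧ ρ (σ 2) = (σ 1) ^ 2 * σ 2
          ∧ ∀ i, 3 ≤ i → i ≤ n - 1 → ρ (σ i) = σ i)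
        ↔ (∀ j, 1 ≤ j → j ≤ n - 1 → ρ (partialProd σ 1 j) = (partialProd σ 1 j)⁻¹))
    ∧ ((∃ ρ : G ≃* G, ρ (σ 1) = (σ 1)⁻¹ ∧ ρ (σ 2) = (σ 1) ^ 2 * σ 2
          ∧ ∀ i, 3 ≤ i → i ≤ n - 1 → ρ (σ i) = σ i)
        ↔ (∃ ρ : G ≃* G, ∀ j, 1 ≤ j → j ≤ n - 1 →
            ρ (partialProd σ 1 j) = (partialProd σ 1 j)⁻¹)) := by
  have key := fun ρ : G ≃* G => map_conditions_iff_map_partialProd_eq_inv (m := n - 1)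
    (by omega) σ (fun j => hsq 1 j le_rfl) ρ.toMonoidHom
  exact ⟨key, exists_congr key⟩
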